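/- Let A be a C*-algebra of stable rank 1 and let a, b be positive elements of A. Then a is Cuntz subequivalent to b if and only if there exists an element x of A such that a = x*x and xx* lies in the closure of bAb (the hereditary subalgebra of A generated by b). -/

import Mathlib

open Filter Topology

/-- `a` is Cuntz subequivalent to `b`: there is a sequence `dₙ` with `dₙ b dₙ* → a`. -/
def CuntzSubequivalent {A : Type*} [NonUnitalRing A] [TopologicalSpace A] [Star A]
    (a b : A) : Prop :=
  ∃ d : ℕ → A, Tendsto (fun n => d n * b * star (d n)) atTop (𝓝 a)

/-- A C*-algebra has stable rank one if the invertible elements of its minimal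
unitization are dense. -/
def StableRankOne (A : Type*) [NonUnitalCStarAlgebra A] : Prop :=
  Dense {x : Unitization ℂ A | IsUnit x}

/-- A continuous piecewise linear function vanishing on `t ≤ 1 / n` and equal to `1` on
`2 / n ≤ t`. -/
noncomputable def cutoff (n t : ℝ) : ℝ := min 1 (max 0 (n * t - 1))

@[fun_prop]
lemma continuous_cutoff (n : ℝ) : Continuous (cutoff n) := by
  unfold cutoff; fun_prop

lemma cutoff_nonneg (n t : ℝ) : 0 ≤ cutoff n t := by simp [cutoff]

lemma cutoff_le_one (n t : ℝ) : cutoff n t ≤ 1 := by simp [cutoff]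

lemma cutoff_two_mul_mul_cutoff (n t : ℝ) :
    cutoff (2 * n) t * cutoff n t = cutoff n t := by
  rcases le_total (n * t) 1 with h | h
  · have : cutoff n t = 0 := by simp [cutoff, h]
    simp [this]
  · have : cutoff (2 * n) t = 1 := by
      rw [cutoff, min_eq_left]; exact le_max_of_le_right (by linarith)
    simp [this]

lemma mul_cutoff_div_max {n : ℝ} (hn : 0 < n) (t : ℝ) :
    t * (cutoff n t / max t n⁻¹) = cutoff n t := by
  rcases le_total t n⁻¹ with h | h
  · have : cutoff n t = 0 := by
      have : n * t ≤ 1 := by rw [← mul_inv_cancel₀ hn.ne']; gcongr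
      simp [cutoff, this]
    simp [this]
  · have : 0 < t := (inv_pos.2 hn).trans_le h
    rw [max_eq_left h]; field_simp

lemma abs_cutoff_mul_sub_le {n : ℝ} (hn : 0 < n) {t : ℝ} (ht : 0 ≤ t) :
    |(1 - cutoff n t) * t| ≤ 2 / n := by
  have h0 := cutoff_nonneg n t
  have h1 := cutoff_le_one n t
  rw [abs_of_nonneg (mul_nonneg (by linarith) ht)]
  rcases le_total (n * t) 2 with h | h
  · rw [le_div_iff₀ hn]
    nlinarith [mul_nonneg hn.le ht]
  · have : cutoff n t = 1 := by
      rw [cutoff, min_eq_left]; exact le_max_of_le_right (by linarith)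
    rw [this]; simp; positivity

section Unital

variable {U : Type*} [CStarAlgebra U]

/-- If `s` acts as the identity on the range of `1 - k` from both sides and the units are dense,
then `s` is a limit of units differing from `s` by an element of `k U k`. -/
lemma exists_isUnit_sub_mem_conjugate (hU : Dense {x : U | IsUnit x}) {s k : U}
    (hsk : s * (1 - k) = 1 - k) (hks : (1 - k) * s = 1 - k) {V : Set U} (hV : V ∈ 𝓝 s) :
    ∃ t ∈ V, IsUnit t ∧ ∃ v, t = s + k * v * k := by
  let p : U → U := fun d => 1 + d * (1 - k)
  let q : U → U := fun d => 1 + (1 - k) * (Ring.inverse (p d) * d) * k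
  let F : U → U := fun d => Ring.inverse (p d) * (s + d) * Ring.inverse (q d)
  have inv_cont : ContinuousAt (Ring.inverse : U → U) 1 := by
    simpa using NormedRing.inverse_continuousAt (1 : Uˣ)
  have hp : ContinuousAt p 0 := by fun_prop
  have hp0 : p 0 = 1 := by simp [p]
  have hpi : ContinuousAt (fun d => Ring.inverse (p d)) 0 :=
    ContinuousAt.comp (g := Ring.inverse) (by rwa [hp0]) hp
  have hq : ContinuousAt q 0 := by fun_prop
  have hq0 : q 0 = 1 := by simp [q]
  have hqi : ContinuousAt (fun d => Ring.inverse (q d)) 0 :=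
    ContinuousAt.comp (g := Ring.inverse) (by rwa [hq0]) hq
  have hF : ContinuousAt F 0 := by fun_prop
  have hF0 : F 0 = s := by simp [F, hp0, hq0]
  have unit_nhds : {x : U | IsUnit x} ∈ 𝓝 (1 : U) := Units.isOpen.mem_nhds isUnit_one
  have e1 : ∀ᶠ d in 𝓝 (0 : U), IsUnit (p d) := hp (by rwa [hp0])
  have e2 : ∀ᶠ d in 𝓝 (0 : U), IsUnit (q d) := hq (by rwa [hq0])
  have e3 : ∀ᶠ d in 𝓝 (0 : U), F d ∈ V := hF (by rwa [hF0])
  have sub_tendsto : Tendsto (fun t : U => t - s) (𝓝 s) (𝓝 0) := by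
    have : ContinuousAt (fun t : U => t - s) s := by fun_prop
    simpa [ContinuousAt] using this
  obtain ⟨t, ⟨⟨h1, h2⟩, h3⟩, ht⟩ := mem_closure_iff_nhds.1 (hU s) _
    (sub_tendsto.eventually ((e1.and e2).and e3))
  set d := t - s with hd
  have hPp := Ring.inverse_mul_cancel _ h1
  have hqQ := Ring.mul_inverse_cancel _ h2
  have hQq := Ring.inverse_mul_cancel _ h2
  refine ⟨F d, h3, ?_, ?_⟩
  · have : s + d = t := by simp [hd]
    simp only [F, this]
    exact (h1.ringInverse.mul ht).mul h2.ringInverse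
  · set P := Ring.inverse (p d)
    set Q := Ring.inverse (q d)
    set d1 := P * d
    have a1 : P * (s + d) = s + d1 * k := by
      have : s + d = p d * s + d * k := by
        simp only [p, add_mul, one_mul, mul_assoc, hks]
        noncomm_ring
      rw [this, mul_add, ← mul_assoc, hPp, one_mul, ← mul_assoc]
    have a2 : s + d1 * k = s * q d + k * d1 * k := by
      have : s * q d = s + (s * (1 - k)) * d1 * k := by
        simp only [q, P, d1]; noncomm_ring
      rw [this, hsk]; noncomm_ring
    have a3 : Q = 1 - Q * (1 - k) * d1 * k := by
      rw [eq_sub_iff_add_eq]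
      refine Eq.trans ?_ hQq
      change Q + _ = Q * (1 + (1 - k) * d1 * k)
      noncomm_ring
    refine ⟨d1 * (1 - k * (Q * (1 - k) * d1)), ?_⟩
    change P * (s + d) * Q = _
    rw [a1, a2, add_mul, mul_assoc s, hqQ, mul_one]
    nth_rewrite 1 [a3]
    noncomm_ring

/-- The closed right ideal generated by an element of a unital C⋆-algebra. -/
noncomputable def closedRightIdeal (b : U) : Submodule ℂ U :=
  (LinearMap.mulLeft ℂ b).range.topologicalClosure

/-- The elements `w` such that left multiplication by `w` and by `star w` preserves `R`. -/
noncomputable def leftMultipliers (R : Submodule ℂ U) : StarSubalgebra ℂ U where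
  carrier := {w | ∀ r ∈ R, w * r ∈ R ∧ star w * r ∈ R}
  mul_mem' {v w} hv hw r hr := by
    rw [star_mul, mul_assoc, mul_assoc]
    exact ⟨(hv _ (hw r hr).1).1, (hw _ (hv r hr).2).2⟩
  add_mem' {v w} hv hw r hr := by
    rw [star_add, add_mul, add_mul]
    exact ⟨add_mem (hv r hr).1 (hw r hr).1, add_mem (hv r hr).2 (hw r hr).2⟩
  algebraMap_mem' c r hr := by
    rw [← algebraMap_star_comm, ← Algebra.smul_def, ← Algebra.smul_def]
    exact ⟨R.smul_mem _ hr, R.smul_mem _ hr⟩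
  star_mem' {w} hw r hr := by
    rw [star_star]
    exact (hw r hr).symm

lemma isClosed_leftMultipliers {R : Submodule ℂ U} (hR : IsClosed (R : Set U)) :
    IsClosed (leftMultipliers R : Set U) := by
  have : (leftMultipliers R : Set U)
      = ⋂ r ∈ R, (fun w => w * r) ⁻¹' R ∩ (fun w => star w * r) ⁻¹' R := by
    ext w; simp [leftMultipliers]
  rw [this]
  exact isClosed_biInter fun r _ => (hR.preimage (by fun_prop)).inter (hR.preimage (by fun_prop))

lemma isClosed_closedRightIdeal (b : U) : IsClosed (closedRightIdeal b : Set U) :=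
  Submodule.isClosed_topologicalClosure _

lemma mem_closedRightIdeal {b x : U} :
    x ∈ closedRightIdeal b ↔ x ∈ closure (Set.range (b * ·)) := by
  rw [closedRightIdeal, ← SetLike.mem_coe, Submodule.topologicalClosure_coe]
  rfl

lemma mul_mem_closedRightIdeal (b c : U) : b * c ∈ closedRightIdeal b :=
  mem_closedRightIdeal.2 (subset_closure ⟨c, rfl⟩)

lemma closedRightIdeal_mul_mem {b x : U} (hx : x ∈ closedRightIdeal b) (c : U) :
    x * c ∈ closedRightIdeal b := by
  rw [mem_closedRightIdeal] at hx ⊢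
  refine map_mem_closure (f := (· * c)) (by fun_prop) hx ?_
  rintro _ ⟨d, rfl⟩
  exact ⟨d * c, (mul_assoc ..).symm⟩

lemma cfc_cutoff_two_mul_mul (b : U) (n : ℝ) :
    cfc (cutoff (2 * n)) b * cfc (cutoff n) b = cfc (cutoff n) b := by
  rw [← cfc_mul ..]
  simp only [cutoff_two_mul_mul_cutoff]

variable [PartialOrder U] [StarOrderedRing U]

lemma norm_sub_sq_le_norm_mul_self_sub {p q : U} (hp : 0 ≤ p) (hq : 0 ≤ q) :
    ‖p - q‖ ^ 2 ≤ ‖p * p - q * q‖ := by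
  have key : ∀ {p q : U}, 0 ≤ p → 0 ≤ q →
      p - q ≤ algebraMap ℝ U √‖p * p - q * q‖ := by
    intro p q hp hq
    set r := √‖p * p - q * q‖ with hr
    have hsa : IsSelfAdjoint (p * p - q * q) := by
      have := hp.isSelfAdjoint
      have := hq.isSelfAdjoint
      simp only [IsSelfAdjoint, star_sub, star_mul] at *
      simp [*]
    have h1 : p * p ≤ q * q + algebraMap ℝ U (r * r) := by
      rw [hr, Real.mul_self_sqrt (norm_nonneg _)]
      exact sub_le_iff_le_add'.1 hsa.le_algebraMap_norm_self
    have hr0 : (0 : ℝ) ≤ r := Real.sqrt_nonneg _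
    have hr1 : 0 ≤ algebraMap ℝ U r := by
      rw [Algebra.algebraMap_eq_smul_one]; exact smul_nonneg hr0 zero_le_one
    have h2 : p * p ≤ (q + algebraMap ℝ U r) * (q + algebraMap ℝ U r) := by
      refine h1.trans ?_
      have : (q + algebraMap ℝ U r) * (q + algebraMap ℝ U r)
          = q * q + algebraMap ℝ U (r * r) + (r • q + r • q) := by
        simp only [Algebra.algebraMap_eq_smul_one, mul_add, add_mul, smul_mul_assoc, mul_smul_comm,
          mul_one, one_mul, smul_smul, smul_add]
        abel
      rw [this]
      exact le_add_of_nonneg_right (add_nonneg (smul_nonneg hr0 hq) (smul_nonneg hr0 hq))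
    have h3 := CFC.sqrt_le_sqrt _ _ h2
    rw [CFC.sqrt_mul_self p hp, CFC.sqrt_mul_self _ (add_nonneg hq hr1)] at h3
    rwa [sub_le_iff_le_add']
  nontriviality U
  have hsa : IsSelfAdjoint (p - q) := hp.isSelfAdjoint.sub hq.isSelfAdjoint
  have h1 := key hp hq
  have h2 := key hq hp
  rw [norm_sub_rev] at h2
  rw [le_algebraMap_iff_spectrum_le (hsa)] at h1
  rw [le_algebraMap_iff_spectrum_le (hq.isSelfAdjoint.sub hp.isSelfAdjoint)] at h2
  suffices ‖p - q‖ ≤ √‖p * p - q * q‖ by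
    rw [← Real.sq_sqrt (norm_nonneg (p * p - q * q))]
    gcongr
  rcases CStarAlgebra.norm_or_neg_norm_mem_spectrum hsa with h | h
  · exact h1 _ h
  · refine h2 _ ?_
    rw [← neg_sub p q, ← spectrum.neg_eq]
    simpa using h

lemma exists_polar_of_isUnit {t : U} (ht : IsUnit t) {D : StarSubalgebra ℂ U}
    (hD : IsClosed (D : Set U)) (htD : t ∈ D) :
    ∃ u ∈ D, star u * u = 1 ∧ ∃ r : U, 0 ≤ r ∧ r * r = star t * t ∧ u * r = t := by
  have hT : IsUnit (star t * t) := ht.star.mul ht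
  have hT0 : 0 ≤ star t * t := star_mul_self_nonneg t
  have hsp : IsStrictlyPositive (star t * t) := hT.isStrictlyPositive hT0
  set T := star t * t with hTdef
  have hTD : T ∈ D := mul_mem (star_mem htD) htD
  have hr : T ^ (-(1 / 2) : ℝ) ∈ D := by
    rw [CFC.rpow_eq_cfc_real hT0]
    exact cfc_mem (𝕜' := ℂ) (hs := hD) _ hTD
  refine ⟨t * T ^ (-(1 / 2) : ℝ), mul_mem htD hr, ?_, T ^ (1 / 2 : ℝ), CFC.rpow_nonneg, ?_, ?_⟩
  · rw [star_mul, (CFC.rpow_nonneg (a := T)).isSelfAdjoint.star_eq, ← mul_assoc,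
      mul_assoc _ _ t, ← hTdef, CFC.conjugate_rpow_neg_one_half T hsp]
  · rw [← CFC.rpow_add hT]; norm_num; exact CFC.rpow_one T hT0
  · rw [mul_assoc, ← CFC.rpow_add hT]; norm_num
    rw [CFC.rpow_zero T hT0, mul_one]

lemma norm_pow_four_le_of_star_mul_self_eq {w x y z : U} (hw : w = z - x)
    (hz : star z * z = star y * y) :
    ‖w‖ ^ 4 ≤ 4 * ‖w * (star y * y)‖ * ‖w‖ + 2 * ‖star x * x - star y * y‖ * ‖w‖ ^ 2 := by
  have h1 : star w * w ≤ 4 * (star y * y) + 2 * (star x * x - star y * y) := by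
    have h := star_mul_self_nonneg (z + x)
    have e : star w * w + star (z + x) * (z + x) = 2 * (star z * z) + 2 * (star x * x) := by
      subst hw; simp only [star_sub, star_add]; noncomm_ring
    rw [hz] at e
    calc star w * w ≤ star w * w + star (z + x) * (z + x) := le_add_of_nonneg_right h
      _ = _ := by rw [e]; noncomm_ring
  have h2 := star_right_conjugate_le_conjugate h1 w
  have h3 : 0 ≤ w * (star w * w) * star w := star_right_conjugate_nonneg (star_mul_self_nonneg w) w
  have h4 := CStarAlgebra.norm_le_norm_of_nonneg_of_le h3 h2
  have h5 : ‖w * (star w * w) * star w‖ = ‖w‖ ^ 4 := by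
    have : w * (star w * w) * star w = star (w * star w) * (w * star w) := by
      simp [mul_assoc]
    rw [this, CStarRing.norm_star_mul_self, CStarRing.norm_self_mul_star]; ring
  rw [← h5]
  refine h4.trans ?_
  have : w * (4 * (star y * y) + 2 * (star x * x - star y * y)) * star w
      = (4 : ℝ) • (w * (star y * y) * star w)
        + (2 : ℝ) • (w * (star x * x - star y * y) * star w) := by
    rw [show (4 : ℝ) = ((4 : ℕ) : ℝ) by norm_num, show (2 : ℝ) = ((2 : ℕ) : ℝ) by norm_num,
      Nat.cast_smul_eq_nsmul, Nat.cast_smul_eq_nsmul]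
    noncomm_ring
  rw [this]
  refine (norm_add_le _ _).trans ?_
  rw [norm_smul, norm_smul, Real.norm_of_nonneg (by norm_num), Real.norm_of_nonneg (by norm_num)]
  have i1 := norm_mul_le (w * (star y * y)) (star w)
  have i2 := norm_mul_le (w * (star x * x - star y * y)) (star w)
  have i3 := norm_mul_le w (star x * x - star y * y)
  rw [norm_star] at i1 i2
  nlinarith [norm_nonneg w, mul_le_mul_of_nonneg_right i3 (norm_nonneg w)]

section Cutoff

variable {b : U}

lemma cfc_cutoff_nonneg (n : ℝ) : 0 ≤ cfc (cutoff n) b := cfc_nonneg fun t _ => cutoff_nonneg n t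

lemma cfc_cutoff_le_one (n : ℝ) : cfc (cutoff n) b ≤ 1 :=
  cfc_le_one _ _ fun t _ => cutoff_le_one n t

lemma exists_cfc_cutoff_eq_mul (hb : 0 ≤ b) {n : ℝ} (hn : 0 < n) :
    ∃ c, cfc (cutoff n) b = b * c := by
  have hc : Continuous (fun t => cutoff n t / max t n⁻¹) :=
    (continuous_cutoff n).div (by fun_prop) fun t =>
      (lt_max_of_lt_right (inv_pos.2 hn)).ne'
  refine ⟨cfc (fun t => cutoff n t / max t n⁻¹) b, ?_⟩
  nth_rewrite 2 [← cfc_id ℝ b hb.isSelfAdjoint]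
  rw [← cfc_mul id _ b continuousOn_id hc.continuousOn]
  simp only [id, mul_cutoff_div_max hn]

lemma norm_one_sub_cfc_cutoff_le (n : ℝ) : ‖1 - cfc (cutoff n) b‖ ≤ 1 := by
  rw [CStarAlgebra.norm_le_one_iff_of_nonneg _ (sub_nonneg.2 (cfc_cutoff_le_one n))]
  simpa using cfc_cutoff_nonneg n

lemma norm_one_sub_cfc_cutoff_mul_le (hb : 0 ≤ b) {n : ℝ} (hn : 0 < n) :
    ‖(1 - cfc (cutoff n) b) * b‖ ≤ 2 / n := by
  have hsa := hb.isSelfAdjoint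
  have : (1 - cfc (cutoff n) b) * b = cfc (fun t => (1 - cutoff n t) * t) b := by
    rw [cfc_mul (fun t => 1 - cutoff n t) (fun t => t) b (by fun_prop) (by fun_prop),
      cfc_sub (fun _ => (1 : ℝ)) (cutoff n) b, cfc_const_one ℝ b, cfc_id' ℝ b]
  rw [this]
  refine norm_cfc_le (by positivity) fun t ht => ?_
  exact abs_cutoff_mul_sub_le hn (spectrum_nonneg_of_nonneg hb ht)

lemma tendsto_cfc_cutoff_mul (hb : 0 ≤ b) {x : U} (hx : x ∈ closedRightIdeal b) :
    Tendsto (fun n : ℝ => cfc (cutoff n) b * x) atTop (𝓝 x) := by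
  rw [mem_closedRightIdeal] at hx
  rw [Metric.tendsto_atTop]
  intro ε hε
  obtain ⟨_, ⟨c, rfl⟩, hc⟩ := Metric.mem_closure_iff.1 hx (ε / 2) (half_pos hε)
  rw [dist_eq_norm] at hc
  have hlim : Tendsto (fun n : ℝ => 2 / n * ‖c‖) atTop (𝓝 0) := by
    simpa using (tendsto_const_nhds.div_atTop tendsto_id).mul_const ‖c‖
  obtain ⟨N, hN⟩ := ((hlim.eventually (gt_mem_nhds (half_pos hε))).and
    (eventually_gt_atTop 0)).exists_forall_of_atTop
  refine ⟨N, fun n hn => ?_⟩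
  obtain ⟨h1, h2⟩ := hN n hn
  set e := cfc (cutoff n) b
  rw [dist_comm, dist_eq_norm]
  have : x - e * x = (1 - e) * (x - b * c) + (1 - e) * b * c := by noncomm_ring
  rw [this]
  calc ‖(1 - e) * (x - b * c) + (1 - e) * b * c‖
      ≤ ‖1 - e‖ * ‖x - b * c‖ + ‖(1 - e) * b‖ * ‖c‖ :=
        (norm_add_le _ _).trans (add_le_add (norm_mul_le _ _) (norm_mul_le _ _))
    _ ≤ 1 * ‖x - b * c‖ + 2 / n * ‖c‖ := by
        gcongr
        · exact norm_one_sub_cfc_cutoff_le n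
        · exact norm_one_sub_cfc_cutoff_mul_le hb h2
    _ < ε := by linarith

/-- `x * star x` in the closed right ideal generated by `b` forces `x` to be there. -/
lemma mem_closedRightIdeal_of_mul_star_mem (hb : 0 ≤ b) {x : U}
    (hx : x * star x ∈ closedRightIdeal b) : x ∈ closedRightIdeal b := by
  have h := tendsto_cfc_cutoff_mul hb hx
  have h' : Tendsto (fun n : ℝ => ‖x * star x - cfc (cutoff n) b * (x * star x)‖) atTop (𝓝 0) := by
    simpa using ((tendsto_const_nhds (x := x * star x)).sub h).norm
  have hsq : Tendsto (fun n : ℝ => ‖x - cfc (cutoff n) b * x‖ ^ 2) atTop (𝓝 0) := by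
    refine squeeze_zero (fun _ => by positivity) (fun n => ?_) h'
    set e := cfc (cutoff n) b
    have he : star (1 - e) = 1 - e := by
      rw [star_sub, star_one, (cfc_cutoff_nonneg n).isSelfAdjoint.star_eq]
    rw [sq, ← CStarRing.norm_self_mul_star]
    have : (x - e * x) * star (x - e * x) = (x * star x - e * (x * star x)) * (1 - e) := by
      have : x - e * x = (1 - e) * x := by noncomm_ring
      rw [this, star_mul, he]; noncomm_ring
    rw [this]
    exact (norm_mul_le _ _).trans
      (mul_le_of_le_one_right (norm_nonneg _) (norm_one_sub_cfc_cutoff_le n))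
  have hn : Tendsto (fun n : ℝ => ‖x - cfc (cutoff n) b * x‖) atTop (𝓝 0) := by
    simpa [Real.sqrt_sq] using hsq.sqrt
  have hlim : Tendsto (fun n : ℝ => cfc (cutoff n) b * x) atTop (𝓝 x) := by
    rw [tendsto_iff_norm_sub_tendsto_zero]
    simpa only [norm_sub_rev] using hn
  refine (isClosed_closedRightIdeal b).mem_of_tendsto hlim ?_
  filter_upwards [eventually_gt_atTop 0] with n hn
  obtain ⟨c, hc⟩ := exists_cfc_cutoff_eq_mul hb hn
  rw [hc, mul_assoc]
  exact mul_mem_closedRightIdeal _ _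

end Cutoff

/-- Given `x` and `y` on which `h` acts as the identity, with `star x * x` close to `star y * y`,
density of the units provides an isometry `u` approximately carrying `y` to `x`, inside any closed
star subalgebra containing `h`, `x * star y` and `k U k` for some `k` with `k * h = h`. -/
lemma exists_isometry_norm_mul_le (hU : Dense {x : U | IsUnit x}) {D : StarSubalgebra ℂ U}
    (hD : IsClosed (D : Set U)) {h k x y : U} (h0 : 0 ≤ h) (h1 : h ≤ 1) (hk : IsSelfAdjoint k)
    (hkh : k * h = h) (hx : h * x = x) (hy : h * y = y) (hhD : h ∈ D) (hxyD : x * star y ∈ D)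
    (hkD : ∀ v, k * v * k ∈ D) {η : ℝ} (hη : 0 < η) :
    ∃ u ∈ D, star u * u = 1 ∧ ‖(u * y - x) * (star y * y)‖ ≤
      ‖y‖ * (√(‖star x * x - star y * y‖ * ‖y‖ ^ 2 + η) + η) := by
  have hhs : star h = h := h0.isSelfAdjoint.star_eq
  have hhk : h * k = h := by simpa [hhs, hk.star_eq] using congrArg star hkh
  have hxs : star x * h = star x := by simpa [hhs] using congrArg star hx
  have hys : star y * h = star y := by simpa [hhs] using congrArg star hy
  have hkx : k * x = x := by rw [← hx, ← mul_assoc, hkh]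
  have hyk : star y * k = star y := by rw [← hys, mul_assoc, hhk]
  set s := x * star y + (1 - h) with hs
  have hsk : s * (1 - k) = 1 - k := by
    simp only [hs, add_mul, mul_sub, sub_mul, mul_assoc, hyk, hhk, mul_one, one_mul]; abel
  have hks : (1 - k) * s = 1 - k := by
    simp only [hs, mul_add, mul_sub, sub_mul, ← mul_assoc, hkx, hkh, mul_one, one_mul]; abel
  have hV : {t : U | ‖t - s‖ < η ∧ ‖star t * t - star s * s‖ < η} ∈ 𝓝 s := by
    have c1 : ContinuousAt (fun t => ‖t - s‖) s := by fun_prop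
    have c2 : ContinuousAt (fun t => ‖star t * t - star s * s‖) s := by fun_prop
    exact (c1.eventually_lt_const (by simpa)).and (c2.eventually_lt_const (by simpa))
  obtain ⟨t, ⟨ht1, ht2⟩, ht, v, htv⟩ := exists_isUnit_sub_mem_conjugate hU hsk hks hV
  have htD : t ∈ D := by
    rw [htv]
    exact add_mem (add_mem hxyD (sub_mem (one_mem _) hhD)) (hkD v)
  obtain ⟨u, huD, hu, r, hr0, hrr, hur⟩ := exists_polar_of_isUnit ht hD htD
  refine ⟨u, huD, hu, ?_⟩
  set q := y * star y + (1 - h) with hq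
  have hq0 : 0 ≤ q := add_nonneg (mul_star_self_nonneg y) (sub_nonneg.2 h1)
  have hqy : q * y = y * (star y * y) := by
    simp only [hq, add_mul, sub_mul, hy, one_mul, mul_assoc, sub_self, add_zero]
  have hsy : s * y = x * (star y * y) := by
    simp only [hs, add_mul, sub_mul, hy, one_mul, mul_assoc, sub_self, add_zero]
  have hsq : star s * s - q * q = y * (star x * x - star y * y) * star y := by
    have e1 : (1 - h) * x = 0 := by rw [sub_mul, one_mul, hx, sub_self]
    have e2 : (1 - h) * y = 0 := by rw [sub_mul, one_mul, hy, sub_self]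
    have e3 : star x * (1 - h) = 0 := by rw [mul_sub, mul_one, hxs, sub_self]
    have e4 : star y * (1 - h) = 0 := by rw [mul_sub, mul_one, hys, sub_self]
    have e5 : star s = y * star x + (1 - h) := by simp [hs, hhs]
    rw [e5, hs, hq]
    generalize 1 - h = g at *
    simp only [add_mul, mul_add, mul_sub, sub_mul, mul_assoc, e3, e4, mul_zero]
    simp only [← mul_assoc, e1, e2, zero_mul]
    abel
  have hrq : ‖r - q‖ ≤ √(‖star x * x - star y * y‖ * ‖y‖ ^ 2 + η) := by
    apply Real.le_sqrt_of_sq_le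
    refine (norm_sub_sq_le_norm_mul_self_sub hr0 hq0).trans ?_
    have : r * r - q * q = y * (star x * x - star y * y) * star y
        + (star t * t - star s * s) := by rw [← hsq, hrr]; abel
    rw [this]
    refine (norm_add_le _ _).trans (add_le_add ?_ ht2.le)
    refine (norm_mul_le _ _).trans ?_
    rw [norm_star]
    nlinarith [norm_mul_le y (star x * x - star y * y), norm_nonneg y]
  have hun : ‖u‖ ≤ 1 := by
    have : ‖u‖ * ‖u‖ ≤ 1 := by
      rw [← CStarRing.norm_star_mul_self, hu]
      nontriviality U
      exact CStarRing.norm_one.le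
    nlinarith [norm_nonneg u]
  have e : (u * y - x) * (star y * y) = (t - s) * y - u * (r - q) * y := by
    rw [sub_mul, sub_mul, mul_sub u, sub_mul, hur, hsy, mul_assoc u q, hqy]
    noncomm_ring
  rw [e]
  calc ‖(t - s) * y - u * (r - q) * y‖ ≤ ‖t - s‖ * ‖y‖ + ‖u‖ * ‖r - q‖ * ‖y‖ :=
        (norm_sub_le _ _).trans (add_le_add (norm_mul_le _ _)
          ((norm_mul_le _ _).trans (by gcongr; exact norm_mul_le _ _)))
    _ ≤ η * ‖y‖ + 1 * √(‖star x * x - star y * y‖ * ‖y‖ ^ 2 + η) * ‖y‖ := by gcongr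
    _ = _ := by ring

lemma exists_isometry_norm_sub_le (hU : Dense {x : U | IsUnit x}) {b : U} (hb : 0 ≤ b)
    {M ρ : ℝ} (hM : 0 ≤ M) (hρ : 0 < ρ) :
    ∃ ε > 0, ∀ x ∈ closedRightIdeal b, ∀ y ∈ closedRightIdeal b, ∀ n : ℝ, 0 < n →
      cfc (cutoff n) b * x = x → cfc (cutoff n) b * y = y → ‖x‖ ≤ M → ‖y‖ ≤ M →
      ‖star x * x - star y * y‖ ≤ ε →
      ∃ u ∈ leftMultipliers (closedRightIdeal b), star u * u = 1 ∧ ‖u * y - x‖ ≤ ρ := by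
  obtain ⟨ε, hε1, hε⟩ : ∃ ε : ℝ, 4 * (M * (√(ε * M ^ 2 + ε) + ε)) + 4 * M * ε < ρ ^ 3 ∧ 0 < ε := by
    have hc : ContinuousAt (fun ε : ℝ => 4 * (M * (√(ε * M ^ 2 + ε) + ε)) + 4 * M * ε) 0 := by
      fun_prop
    have := (hc.eventually_lt_const (u := ρ ^ 3) (by simp; positivity)).filter_mono
      (nhdsWithin_le_nhds (s := Set.Ioi 0))
    exact (this.and self_mem_nhdsWithin).exists
  refine ⟨ε, hε, fun x hx y hy n hn hnx hny hxM hyM hxy => ?_⟩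
  obtain ⟨c, hc⟩ := exists_cfc_cutoff_eq_mul hb hn
  obtain ⟨c', hc'⟩ := exists_cfc_cutoff_eq_mul hb (n := 2 * n) (by positivity)
  have hksa : star (cfc (cutoff (2 * n)) b) = cfc (cutoff (2 * n)) b :=
    (cfc_cutoff_nonneg (2 * n)).isSelfAdjoint.star_eq
  obtain ⟨u, huD, hu, hκ⟩ := exists_isometry_norm_mul_le hU
    (isClosed_leftMultipliers (isClosed_closedRightIdeal b))
    (cfc_cutoff_nonneg n) (cfc_cutoff_le_one n) hksa
    (cfc_cutoff_two_mul_mul b n) hnx hny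
    (fun r _ => by
      rw [(cfc_cutoff_nonneg n).isSelfAdjoint.star_eq, hc, mul_assoc]
      exact ⟨mul_mem_closedRightIdeal _ _, mul_mem_closedRightIdeal _ _⟩)
    (fun r _ => by
      rw [star_mul, star_star, mul_assoc, mul_assoc]
      exact ⟨closedRightIdeal_mul_mem hx _, closedRightIdeal_mul_mem hy _⟩)
    (fun v r _ => by
      rw [star_mul, star_mul, hksa]
      nth_rewrite 1 [hc']
      nth_rewrite 2 [hc']
      simp only [mul_assoc]
      exact ⟨mul_mem_closedRightIdeal _ _, mul_mem_closedRightIdeal _ _⟩) hε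
  refine ⟨u, huD, hu, ?_⟩
  have hz : star (u * y) * (u * y) = star y * y := by
    rw [star_mul, mul_assoc, ← mul_assoc (star u), hu, one_mul]
  have h4 := norm_pow_four_le_of_star_mul_self_eq (w := u * y - x) (x := x) rfl hz
  have hw : ‖u * y - x‖ ≤ 2 * M := by
    have : ‖u * y‖ = ‖y‖ := by
      rw [← sq_eq_sq₀ (norm_nonneg _) (norm_nonneg _), sq, sq, ← CStarRing.norm_star_mul_self, hz,
        CStarRing.norm_star_mul_self]
    linarith [norm_sub_le (u * y) x]
  have hκ' : ‖(u * y - x) * (star y * y)‖ ≤ M * (√(ε * M ^ 2 + ε) + ε) := hκ.trans (by gcongr)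
  set w := ‖u * y - x‖
  by_contra! hlt
  have hw0 : 0 < w := hρ.trans hlt
  have h3 : w ^ 3 ≤ 4 * (M * (√(ε * M ^ 2 + ε) + ε)) + 4 * M * ε := by
    refine le_of_mul_le_mul_right ?_ hw0
    calc w ^ 3 * w = w ^ 4 := by ring
      _ ≤ _ := h4
      _ ≤ 4 * (M * (√(ε * M ^ 2 + ε) + ε)) * w + 2 * ε * (w * (2 * M)) := by
        rw [sq w]; gcongr
      _ = _ := by ring
  have : ρ ^ 3 < w ^ 3 := by gcongr
  linarith

lemma exists_mem_closedRightIdeal_near (hU : Dense {x : U | IsUnit x}) {a b : U} (hb : 0 ≤ b)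
    (hab : ∀ ε > 0, ∃ y ∈ closedRightIdeal b, ‖star y * y - a‖ < ε) {ρ : ℝ} (hρ : 0 < ρ) :
    ∃ ε > 0, ∀ x ∈ closedRightIdeal b, ‖star x * x - a‖ < ε → ∀ ε' > 0,
      ∃ z ∈ closedRightIdeal b, ‖star z * z - a‖ < ε' ∧ ‖z - x‖ < ρ := by
  obtain ⟨ε, hε, key⟩ := exists_isometry_norm_sub_le hU hb (M := ‖a‖ + 1) (ρ := ρ / 2)
    (by positivity) (by positivity)
  have hbound : ∀ x : U, ‖star x * x - a‖ < 1 → ‖x‖ ≤ ‖a‖ + 1 := fun x hx => by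
    have h1 : ‖star x * x‖ ≤ ‖a‖ + 1 := by linarith [norm_le_norm_add_norm_sub' (star x * x) a]
    rw [CStarRing.norm_star_mul_self] at h1
    by_contra! h
    nlinarith [norm_nonneg a]
  refine ⟨min 1 (ε / 2), by positivity, fun x hx hxa ε' hε' => ?_⟩
  obtain ⟨y, hy, hya⟩ := hab (min ε' (min 1 (ε / 2))) (by positivity)
  have near : ∀ {x : U} {δ : ℝ}, ‖star x * x - a‖ < δ →
      x ∈ closedRightIdeal b → ∀ᶠ n : ℝ in atTop,
        ‖star (cfc (cutoff n) b * x) * (cfc (cutoff n) b * x) - a‖ < δ := fun hx hxR => by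
    have ht := tendsto_cfc_cutoff_mul hb hxR
    exact ((ht.star.mul ht).sub_const a).norm.eventually_lt_const hx
  have hxx : ∀ᶠ n : ℝ in atTop, ‖cfc (cutoff n) b * x - x‖ < ρ / 2 :=
    ((tendsto_cfc_cutoff_mul hb hx).sub_const x).norm.eventually_lt_const (by simpa)
  obtain ⟨n, ⟨⟨hn1, hn2⟩, hn3⟩, hn⟩ := (((near hxa hx).and (near hya hy)).and hxx).and
    (eventually_gt_atTop (0 : ℝ)) |>.exists
  set x' := cfc (cutoff n) b * x
  set y' := cfc (cutoff n) b * y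
  rw [lt_min_iff] at hn1
  rw [lt_min_iff, lt_min_iff] at hn2
  obtain ⟨c, hc⟩ := exists_cfc_cutoff_eq_mul hb hn
  have hmem : ∀ v, cfc (cutoff n) b * v ∈ closedRightIdeal b := fun v => by
    rw [hc, mul_assoc]; exact mul_mem_closedRightIdeal _ _
  obtain ⟨u, huD, hu, hux⟩ := key x' (hmem x) y' (hmem y) (2 * n) (by positivity)
    (by rw [← mul_assoc, cfc_cutoff_two_mul_mul]) (by rw [← mul_assoc, cfc_cutoff_two_mul_mul])
    (hbound _ hn1.1) (hbound _ hn2.2.1) (by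
      have : star x' * x' - star y' * y' = (star x' * x' - a) - (star y' * y' - a) := by abel
      rw [this]
      linarith [norm_sub_le (star x' * x' - a) (star y' * y' - a), hn1.2, hn2.2.2])
  refine ⟨u * y', (huD _ (hmem y)).1, ?_, ?_⟩
  · rw [star_mul, mul_assoc, ← mul_assoc (star u), hu, one_mul]
    exact hn2.1
  · have : u * y' - x = (u * y' - x') + (x' - x) := by abel
    rw [this]
    linarith [norm_add_le (u * y' - x') (x' - x)]

theorem exists_mem_closedRightIdeal_star_mul_self_eq (hU : Dense {x : U | IsUnit x}) {a b : U}
    (hb : 0 ≤ b) (hab : ∀ ε > 0, ∃ y ∈ closedRightIdeal b, ‖star y * y - a‖ < ε) :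
    ∃ x ∈ closedRightIdeal b, star x * x = a := by
  choose ε hε key using fun n : ℕ =>
    exists_mem_closedRightIdeal_near hU hb hab (ρ := (1 / 2) ^ n) (by positivity)
  let δ : ℕ → ℝ := fun n => min (ε n) ((1 / 2) ^ n)
  have hδ : ∀ n, 0 < δ n := fun n => lt_min (hε n) (by positivity)
  let S : ℕ → Type _ := fun n => {x : U // x ∈ closedRightIdeal b ∧ ‖star x * x - a‖ < δ n}
  have step : ∀ n (x : S n), ∃ z : S (n + 1), ‖z.1 - x.1‖ < (1 / 2) ^ n := fun n x => by
    obtain ⟨z, hz, hza, hzx⟩ := key n x.1 x.2.1 (x.2.2.trans_le (min_le_left _ _)) _ (hδ (n + 1))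
    exact ⟨⟨z, hz, hza⟩, hzx⟩
  choose next hnext using step
  obtain ⟨x₀, hx₀⟩ := hab (δ 0) (hδ 0)
  let X : ∀ n, S n := fun n => Nat.rec ⟨x₀, hx₀⟩ (fun n x => next n x) n
  have hX : ∀ n, dist (X n).1 (X (n + 1)).1 ≤ (1 / 2) ^ n := fun n => by
    rw [dist_comm, dist_eq_norm]
    exact (hnext n (X n)).le
  obtain ⟨x, hx⟩ := cauchySeq_tendsto_of_complete
    (cauchySeq_of_dist_le_of_summable _ hX summable_geometric_two)
  refine ⟨x, (isClosed_closedRightIdeal b).mem_of_tendsto hx (.of_forall fun n => (X n).2.1), ?_⟩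
  refine tendsto_nhds_unique (hx.star.mul hx) ?_
  rw [tendsto_iff_norm_sub_tendsto_zero]
  refine squeeze_zero (fun _ => norm_nonneg _) (fun n => ?_)
    (tendsto_pow_atTop_nhds_zero_of_lt_one (r := (1 / 2 : ℝ)) (by norm_num) (by norm_num))
  exact ((X n).2.2.trans_le (min_le_right _ _)).le

end Unital

namespace Unitization

variable {A : Type*} [NonUnitalCStarAlgebra A]

lemma exists_mul_inr_eq (p : Unitization ℂ A) (q : A) :
    ∃ r : A, p * (q : Unitization ℂ A) = r := by
  refine ⟨(p * (q : Unitization ℂ A)).snd, ?_⟩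
  ext <;> simp

lemma mem_range_inr_of_mem_closedRightIdeal {b : A} {x : Unitization ℂ A}
    (hx : x ∈ closedRightIdeal (b : Unitization ℂ A)) : ∃ y : A, x = y := by
  have hcl : IsClosed (Set.range (inr : A → Unitization ℂ A)) :=
    (isometry_inr (𝕜 := ℂ) (A := A)).isClosedEmbedding.isClosed_range
  have : x ∈ Set.range (inr : A → Unitization ℂ A) := by
    refine closure_minimal ?_ hcl (mem_closedRightIdeal.1 hx)
    rintro _ ⟨c, rfl⟩
    exact ⟨((b : Unitization ℂ A) * c).snd, by ext <;> simp⟩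
  obtain ⟨y, rfl⟩ := this
  exact ⟨y, rfl⟩

variable [PartialOrder A] [StarOrderedRing A]

lemma mem_closure_conjugate_of_inr_mem_closedRightIdeal {b x : A} (hb : 0 ≤ b)
    (hx : (x : Unitization ℂ A) ∈ closedRightIdeal (b : Unitization ℂ A)) :
    x * star x ∈ closure {y : A | ∃ c : A, y = b * c * b} := by
  have hconj : ∀ c : Unitization ℂ A,
      ∃ y ∈ closure {y : A | ∃ c : A, y = b * c * b},
        (b : Unitization ℂ A) * c * (b : Unitization ℂ A) = y := fun c => by
    refine ⟨c.fst • (b * b) + b * c.snd * b, ?_, ?_⟩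
    · have hl := CStarAlgebra.increasingApproximateUnit (A := A)
      have hlim : Tendsto (fun e => b * (c.fst • e + c.snd) * b)
          (CStarAlgebra.approximateUnit A) (𝓝 (c.fst • (b * b) + b * c.snd * b)) := by
        have h := ((hl.tendsto_mul_left b).const_smul c.fst).mul_const b
        simpa only [mul_add, add_mul, mul_smul_comm, smul_mul_assoc] using
          h.add_const (b * c.snd * b)
      have := hl.neBot
      exact mem_closure_of_tendsto hlim (.of_forall fun e => ⟨_, rfl⟩)
    · ext <;> simp [add_mul, smul_mul_assoc]
  have hbs : star (b : Unitization ℂ A) = b := by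
    rw [← inr_star, hb.isSelfAdjoint.star_eq]
  obtain ⟨z, hz, hzx⟩ := mem_closure_iff_seq_limit.1 (mem_closedRightIdeal.1 hx)
  choose c hc using hz
  choose y hy hyc using fun n => hconj (c n * star (c n))
  rw [← closure_closure]
  refine mem_closure_of_tendsto (f := y) (b := atTop) ?_ (.of_forall hy)
  rw [(isometry_inr (𝕜 := ℂ) (A := A)).isEmbedding.tendsto_nhds_iff]
  have h := hzx.mul hzx.star
  rw [← inr_star, ← inr_mul] at h
  refine h.congr fun n => ?_
  rw [Function.comp_apply, ← hyc, ← hc n, star_mul, hbs]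
  simp only [mul_assoc]

end Unitization

/-- For a C*-algebra of stable rank one and positive elements `a, b`, one has `a ≾ b`
iff there is `x` with `a = x*x` and `xx*` in the hereditary subalgebra generated by `b`
(the closure of `bAb`). -/
theorem cuntzSubequivalent_iff_of_stableRankOne
    {A : Type*} [NonUnitalCStarAlgebra A] [PartialOrder A] [StarOrderedRing A]
    (hA : StableRankOne A) (a b : A) (ha : 0 ≤ a) (hb : 0 ≤ b) :
    CuntzSubequivalent a b ↔
      ∃ x : A, a = star x * x ∧
        x * star x ∈ closure {y : A | ∃ c : A, y = b * c * b} := by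
  have hb' : 0 ≤ (b : Unitization ℂ A) := Unitization.inr_nonneg_iff.2 hb
  obtain ⟨q, hss, hsb⟩ : ∃ q : A, star q = q ∧ q * q = b :=
    ⟨CFC.sqrt b, (CFC.sqrt_nonneg b).isSelfAdjoint.star_eq, CFC.sqrt_mul_sqrt_self b hb⟩
  have hinr := Unitization.isometry_inr (𝕜 := ℂ) (A := A)
  constructor
  · rintro ⟨d, hd⟩
    have hsqrt : (q : Unitization ℂ A) ∈ closedRightIdeal (b : Unitization ℂ A) := by
      refine mem_closedRightIdeal_of_mul_star_mem hb' ?_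
      rw [← Unitization.inr_star, hss, ← Unitization.inr_mul, hsb]
      simpa using mul_mem_closedRightIdeal (b : Unitization ℂ A) 1
    obtain ⟨x, hx, hxa⟩ := exists_mem_closedRightIdeal_star_mul_self_eq hA
      (a := (a : Unitization ℂ A)) hb' fun ε hε => by
        obtain ⟨n, hn⟩ := (Metric.tendsto_nhds.1 hd ε hε).exists
        refine ⟨_, closedRightIdeal_mul_mem hsqrt (star (d n : Unitization ℂ A)), ?_⟩
        rw [dist_eq_norm, ← Unitization.norm_inr (𝕜 := ℂ)] at hn
        convert hn using 2
        rw [← Unitization.inr_star, ← Unitization.inr_mul, ← Unitization.inr_star,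
          ← Unitization.inr_mul, ← Unitization.inr_sub, star_mul, star_star, hss, mul_assoc,
          ← mul_assoc q, hsb, mul_assoc]
    obtain ⟨y, rfl⟩ := Unitization.mem_range_inr_of_mem_closedRightIdeal hx
    refine ⟨y, hinr.injective ?_,
      Unitization.mem_closure_conjugate_of_inr_mem_closedRightIdeal hb hx⟩
    rw [← hxa, Unitization.inr_mul, Unitization.inr_star]
  · rintro ⟨x, rfl, hx⟩
    have hxR : (x : Unitization ℂ A) ∈ closedRightIdeal (b : Unitization ℂ A) := by
      refine mem_closedRightIdeal_of_mul_star_mem hb' ?_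
      rw [← Unitization.inr_star, ← Unitization.inr_mul, mem_closedRightIdeal]
      refine map_mem_closure hinr.continuous hx ?_
      rintro _ ⟨c, rfl⟩
      exact ⟨(c * b : A), by simp [mul_assoc]⟩
    obtain ⟨z, hz, hzx⟩ := mem_closure_iff_seq_limit.1 (mem_closedRightIdeal.1 hxR)
    choose c hc using hz
    choose d hd using fun n => Unitization.exists_mul_inr_eq (star (c n)) q
    refine ⟨d, ?_⟩
    rw [hinr.isEmbedding.tendsto_nhds_iff, Unitization.inr_mul, Unitization.inr_star]
    refine (hzx.star.mul hzx).congr fun n => ?_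
    have hsb' : (q : Unitization ℂ A) * (q : Unitization ℂ A) = b := by
      rw [← Unitization.inr_mul, hsb]
    have hss' : star (q : Unitization ℂ A) = q := by
      rw [← Unitization.inr_star, hss]
    rw [Function.comp_apply, Unitization.inr_mul, Unitization.inr_mul, Unitization.inr_star, ← hd,
      ← hc n, star_mul, star_mul, star_star, hss', hb'.isSelfAdjoint.star_eq]
    rw [← hsb']
    simp only [mul_assoc]
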